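/- Let i be a nonnegative integer and let α, β be complex numbers. Assume that (β)_{m+n}, (α/2)_n and (1+(α+β)/2)_n are nonzero for all nonnegative integers m, n, that no argument of Γ appearing on the right-hand side below is a nonpositive integer, and that the double series defining the Kampé de Fériet function converges absolutely. Then F^{1:1;3}_{1:0;2}[α : α+β−i ; i−α, 1+α/2, (α−β)/2 ; β : — ; α/2, 1+(α+β)/2 ; −1, −1] = (Γ(−α) · Γ(1+(α+β)/2)) / (Γ(i−α) · Γ(β/2+3α/2−i+1)) · Σ_{r=0}^{i} (−1)^r · C(i,r) · Γ(β/4+3α/4+(r+1−i)/2) / Γ(β/4−α/4+(r+1−i)/2). -/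

import Mathlib

open Complex

noncomputable section

/-- Pochhammer symbol `(a)_n = a (a+1) ⋯ (a+n-1)`. -/
def poch (a : ℂ) (n : ℕ) : ℂ := ∏ k ∈ Finset.range n, (a + k)

/-- `z` is not a nonpositive integer. -/
def notNonposInt (z : ℂ) : Prop := ∀ n : ℕ, z ≠ -(n : ℂ)

/-- Term of the Kampé de Fériet double series `F^{1:1;3}_{1:0;2}`. -/
def kdfTerm (α ε b₁ b₂ b₃ β d₁ d₂ x y : ℂ) (p : ℕ × ℕ) : ℂ :=
  poch α (p.1 + p.2) * poch ε p.1 * poch b₁ p.2 * poch b₂ p.2 * poch b₃ p.2 /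
    (poch β (p.1 + p.2) * poch d₁ p.2 * poch d₂ p.2) * x ^ p.1 * y ^ p.2 /
    ((p.1.factorial : ℂ) * (p.2.factorial : ℂ))

section

open Filter Topology Finset

theorem poch_zero (a : ℂ) : poch a 0 = 1 := by simp [poch]

theorem poch_succ (a : ℂ) (n : ℕ) : poch a (n + 1) = poch a n * (a + n) := by
  simp [poch, prod_range_succ]

theorem poch_add (a : ℂ) (m n : ℕ) : poch a (m + n) = poch a m * poch (a + m) n := by
  simp only [poch, prod_range_add]
  congr 1
  refine prod_congr rfl fun k _ => ?_
  push_cast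
  ring

theorem poch_succ_left (a : ℂ) (n : ℕ) : poch a (n + 1) = a * poch (a + 1) n := by
  rw [add_comm n 1, poch_add]
  simp [poch]

/-- The Chu–Vandermonde sum with denominators cleared. -/
theorem sum_choose_poch_mul_poch (M : ℕ) : ∀ b c : ℂ,
    ∑ j ∈ range (M + 1), (M.choose j : ℂ) * ((-1) ^ j * poch b j * poch (c + j) (M - j)) =
      poch (c - b) M := by
  induction M with
  | zero => intro b c; simp [poch_zero]
  | succ M ih =>
    intro b c
    rw [Finset.sum_choose_succ_mul (fun i j => (-1) ^ i * poch b i * poch (c + i) j) M]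
    have h1 : ∀ j ∈ range (M + 1), (M.choose j : ℂ) *
        ((-1) ^ j * poch b j * poch (c + j) (M + 1 - j)) =
        (c + M) * ((M.choose j : ℂ) * ((-1) ^ j * poch b j * poch (c + j) (M - j))) := by
      intro j hj
      have hj' : j ≤ M := Nat.lt_succ_iff.mp (mem_range.mp hj)
      rw [Nat.succ_sub hj', poch_succ, Nat.cast_sub hj']
      ring
    have h2 : ∀ j ∈ range (M + 1), (M.choose j : ℂ) *
        ((-1) ^ (j + 1) * poch b (j + 1) * poch (c + (j + 1 : ℕ)) (M - j)) =
        (-b) * ((M.choose j : ℂ) *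
          ((-1) ^ j * poch (b + 1) j * poch ((c + 1) + j) (M - j))) := by
      intro j _
      rw [poch_succ_left, show c + ((j + 1 : ℕ) : ℂ) = c + 1 + j by push_cast; ring]
      ring
    rw [sum_congr rfl h1, sum_congr rfl h2, ← mul_sum, ← mul_sum, ih b c, ih (b + 1) (c + 1),
      show c + 1 - (b + 1) = c - b by ring, poch_succ]
    ring

/-- A very-well-poised variant of the Chu–Vandermonde sum, with denominators cleared. -/
theorem sum_choose_poch_mul_poch_mul_linear (M : ℕ) : ∀ q d : ℂ,
    ∑ j ∈ range (M + 1), (M.choose j : ℂ) *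
      ((-1) ^ j * poch q j * poch (d + j) (M - j) * (d - 1 + q + 2 * j)) =
      poch (d - 1 - q) M * (d - 1 + q + M) := by
  induction M with
  | zero => intro b c; simp [poch_zero]
  | succ M ih =>
    intro b c
    rw [Finset.sum_choose_succ_mul
      (fun i j => (-1) ^ i * poch b i * poch (c + i) j * (c - 1 + b + 2 * i)) M]
    have h1 : ∀ j ∈ range (M + 1), (M.choose j : ℂ) *
        ((-1) ^ j * poch b j * poch (c + j) (M + 1 - j) * (c - 1 + b + 2 * j)) =
        (c + M) * ((M.choose j : ℂ) *
          ((-1) ^ j * poch b j * poch (c + j) (M - j) * (c - 1 + b + 2 * j))) := by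
      intro j hj
      have hj' : j ≤ M := Nat.lt_succ_iff.mp (mem_range.mp hj)
      rw [Nat.succ_sub hj', poch_succ, Nat.cast_sub hj']
      ring
    have h2 : ∀ j ∈ range (M + 1), (M.choose j : ℂ) *
        ((-1) ^ (j + 1) * poch b (j + 1) * poch (c + (j + 1 : ℕ)) (M - j) *
          (c - 1 + b + 2 * (j + 1 : ℕ))) =
        (-b) * ((M.choose j : ℂ) *
          ((-1) ^ j * poch (b + 1) j * poch ((c + 1) + j) (M - j) *
            (c + 1 - 1 + (b + 1) + 2 * j))) := by
      intro j _
      rw [poch_succ_left, show c + ((j + 1 : ℕ) : ℂ) = c + 1 + j by push_cast; ring]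
      push_cast
      ring
    rw [sum_congr rfl h1, sum_congr rfl h2, ← mul_sum, ← mul_sum, ih b c, ih (b + 1) (c + 1),
      show c + 1 - 1 - (b + 1) = c - 1 - b by ring, poch_succ]
    push_cast
    ring

theorem sum_antidiagonal_poch_div_factorial (M : ℕ) (b c : ℂ) :
    ∑ p ∈ antidiagonal M, (-1) ^ p.1 * poch b p.1 * poch (c + p.1) p.2 /
      ((p.1.factorial : ℂ) * p.2.factorial) = poch (c - b) M / M.factorial := by
  rw [← sum_choose_poch_mul_poch M b c, sum_div, Finset.Nat.sum_antidiagonal_eq_sum_range_succ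
    (fun i j => (-1) ^ i * poch b i * poch (c + i) j / ((i.factorial : ℂ) * j.factorial)) M]
  refine sum_congr rfl fun j hj => ?_
  rw [Nat.cast_choose ℂ (Nat.lt_succ_iff.mp (mem_range.mp hj))]
  have := Nat.cast_ne_zero (R := ℂ).mpr M.factorial_ne_zero
  field_simp

theorem sum_antidiagonal_poch_mul_linear_div_factorial (M : ℕ) (q d : ℂ) :
    ∑ p ∈ antidiagonal M, (-1) ^ p.1 * poch q p.1 * poch (d + p.1) p.2 *
      (d - 1 + q + 2 * p.1) / ((p.1.factorial : ℂ) * p.2.factorial) =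
      poch (d - 1 - q) M * (d - 1 + q + M) / M.factorial := by
  rw [← sum_choose_poch_mul_poch_mul_linear M q d, sum_div,
    Finset.Nat.sum_antidiagonal_eq_sum_range_succ
    (fun i j => (-1) ^ i * poch q i * poch (d + i) j * (d - 1 + q + 2 * i) /
      ((i.factorial : ℂ) * j.factorial)) M]
  refine sum_congr rfl fun j hj => ?_
  rw [Nat.cast_choose ℂ (Nat.lt_succ_iff.mp (mem_range.mp hj))]
  have := Nat.cast_ne_zero (R := ℂ).mpr M.factorial_ne_zero
  field_simp

theorem sum_antidiagonal_assoc (N : ℕ) (f : ℕ → ℕ → ℕ → ℂ) :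
    ∑ p ∈ antidiagonal N, ∑ q ∈ antidiagonal p.1, f p.2 q.1 q.2 =
      ∑ p ∈ antidiagonal N, ∑ q ∈ antidiagonal p.1, f q.1 q.2 p.2 := by
  rw [sum_sigma', sum_sigma']
  refine sum_nbij' (fun x => ⟨(x.1.2 + x.2.1, x.2.2), (x.1.2, x.2.1)⟩)
    (fun x => ⟨(x.2.2 + x.1.2, x.2.1), (x.2.2, x.1.2)⟩) ?_ ?_ ?_ ?_ ?_
  · rintro ⟨⟨a, b⟩, ⟨c, d⟩⟩ h
    simp only [mem_sigma, HasAntidiagonal.mem_antidiagonal] at h ⊢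
    exact ⟨by omega, by trivial⟩
  · rintro ⟨⟨a, b⟩, ⟨c, d⟩⟩ h
    simp only [mem_sigma, HasAntidiagonal.mem_antidiagonal] at h ⊢
    exact ⟨by omega, by trivial⟩
  · rintro ⟨⟨a, b⟩, ⟨c, d⟩⟩ h
    simp only [mem_sigma, HasAntidiagonal.mem_antidiagonal] at h
    obtain ⟨h1, rfl⟩ := h
    rfl
  · rintro ⟨⟨a, b⟩, ⟨c, d⟩⟩ h
    simp only [mem_sigma, HasAntidiagonal.mem_antidiagonal] at h
    obtain ⟨h1, rfl⟩ := h
    rfl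
  · intros
    rfl

theorem poch_ratio_succ (a : ℂ) (n : ℕ) : poch (1 + a) n * a = poch a n * (a + n) := by
  rw [add_comm 1 a, mul_comm, ← poch_succ_left, poch_succ]

/-- The diagonal sums of the Kampé de Fériet series. -/
theorem sum_antidiagonal_kdfTerm (α β b : ℂ) (N : ℕ)
    (hβ : ∀ n : ℕ, poch β n ≠ 0)
    (hd1 : ∀ n : ℕ, poch (α / 2) n ≠ 0)
    (hd2 : ∀ n : ℕ, poch (1 + (α + β) / 2) n ≠ 0) :
    ∑ p ∈ antidiagonal N, kdfTerm α (β - b) b (1 + α / 2) ((α - β) / 2) β (α / 2)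
      (1 + (α + β) / 2) (-1) (-1) p =
    (-1) ^ N * ∑ p ∈ antidiagonal N, ((-1) ^ p.1 * poch b p.1 * poch (1 + α) p.1 /
      (poch (1 + (α + β) / 2) p.1 * p.1.factorial)) *
        (poch (α + p.1) p.2 / p.2.factorial) := by
  have hα : α ≠ 0 := by
    have := hd1 1
    simpa [poch] using this
  set q := (α - β) / 2 with hq
  set d := 1 + (α + β) / 2 with hd
  have e1 : d - 1 + q = α := by rw [hq, hd]; ring
  have e2 : d - 1 - q = β := by rw [hq, hd]; ring
  have fac : ∀ n : ℕ, (n.factorial : ℂ) ≠ 0 := fun n =>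
    Nat.cast_ne_zero.mpr n.factorial_ne_zero
  have hβ' : ∀ m n : ℕ, poch (β + m) n ≠ 0 := fun m n => by
    have := hβ (m + n)
    rw [poch_add] at this
    exact right_ne_zero_of_mul this
  have hd' : ∀ m n : ℕ, poch (d + m) n ≠ 0 := fun m n => by
    have := hd2 (m + n)
    rw [poch_add] at this
    exact right_ne_zero_of_mul this
  have hwp : ∀ n : ℕ, poch (1 + α / 2) n / poch (α / 2) n = (α + 2 * n) / α := by
    intro n
    have := poch_ratio_succ (α / 2) n
    rw [div_eq_div_iff (hd1 n) hα]
    linear_combination 2 * this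
  have L : ∀ p ∈ antidiagonal N, kdfTerm α (β - b) b (1 + α / 2) q β (α / 2) d (-1) (-1) p =
      ∑ r ∈ antidiagonal p.1, (-1) ^ N * (poch α N / (poch β N * α)) *
        ((-1) ^ r.1 * poch b (p.2 + r.1) * poch (β + (p.2 + r.1 : ℕ)) r.2 * poch q p.2 *
          (α + 2 * p.2) /
          (poch d p.2 * p.2.factorial * r.1.factorial * r.2.factorial)) := by
    intro p hp
    have hp' : p.1 + p.2 = N := HasAntidiagonal.mem_antidiagonal.mp hp
    have hv := sum_antidiagonal_poch_div_factorial p.1 (b + p.2) (β + p.2)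
    rw [show β + (p.2 : ℂ) - (b + p.2) = β - b by ring] at hv
    have : kdfTerm α (β - b) b (1 + α / 2) q β (α / 2) d (-1) (-1) p =
        (-1) ^ N * (poch α N / (poch β N)) * (poch (1 + α / 2) p.2 / poch (α / 2) p.2) *
        (poch b p.2 * poch q p.2 / (poch d p.2 * p.2.factorial)) *
        (poch (β - b) p.1 / p.1.factorial) := by
      rw [kdfTerm, ← hp']
      have h1 := hd1 p.2
      have h2 := hd2 p.2
      have h3 := hβ (p.1 + p.2)
      have h4 := fac p.1
      have h5 := fac p.2
      rw [pow_add]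
      field_simp
    rw [this, ← hv, mul_sum, hwp]
    refine sum_congr rfl fun r _ => ?_
    rw [poch_add b]
    have h2 := hd2 p.2
    have h3 := hβ N
    have h4 := fac r.1
    have h5 := fac p.2
    have h6 := fac r.2
    push_cast
    rw [← add_assoc]
    field_simp
  rw [sum_congr rfl L, sum_antidiagonal_assoc N (fun n j l =>
    (-1) ^ N * (poch α N / (poch β N * α)) *
        ((-1) ^ j * poch b (n + j) * poch (β + (n + j : ℕ)) l * poch q n *
          (α + 2 * n) / (poch d n * n.factorial * j.factorial * l.factorial))), mul_sum]
  refine sum_congr rfl fun p hp => ?_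
  have hp' : p.1 + p.2 = N := HasAntidiagonal.mem_antidiagonal.mp hp
  have hi := sum_antidiagonal_poch_mul_linear_div_factorial p.1 q d
  rw [e1, e2] at hi
  have key : ∀ r ∈ antidiagonal p.1, (-1) ^ N * (poch α N / (poch β N * α)) *
        ((-1) ^ r.2 * poch b (r.1 + r.2) * poch (β + (r.1 + r.2 : ℕ)) p.2 * poch q r.1 *
          (α + 2 * r.1) / (poch d r.1 * r.1.factorial * r.2.factorial * p.2.factorial)) =
      ((-1) ^ N * (poch α N / (poch β p.1 * α)) * (-1) ^ p.1 * poch b p.1 /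
        (poch d p.1 * p.2.factorial)) *
        ((-1) ^ r.1 * poch q r.1 * poch (d + r.1) r.2 * (α + 2 * r.1) /
          ((r.1.factorial : ℂ) * r.2.factorial)) := by
    intro r hr
    have hr' : r.1 + r.2 = p.1 := HasAntidiagonal.mem_antidiagonal.mp hr
    have s : (-1 : ℂ) ^ p.1 * (-1) ^ r.1 = (-1) ^ r.2 := by
      rw [← hr', pow_add, mul_right_comm, ← mul_pow]; simp
    rw [hr', ← s, show poch β N = poch β p.1 * poch (β + p.1) p.2 by rw [← hp', poch_add],
      show poch d p.1 = poch d r.1 * poch (d + r.1) r.2 by rw [← hr', poch_add]]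
    have h1 := hβ p.1
    have h2 := hβ' p.1 p.2
    have h3 := hd2 r.1
    have h4 := hd' r.1 r.2
    have h5 := fac r.1
    have h6 := fac r.2
    have h7 := fac p.2
    field_simp
  rw [sum_congr rfl key, ← mul_sum, hi, show poch α N = poch α p.1 * poch (α + p.1) p.2 by
    rw [← hp', poch_add]]
  have hr := poch_ratio_succ α p.1
  have h1 := hβ p.1
  have h3 := hd2 p.1
  have h5 := fac p.1
  have h7 := fac p.2
  rw [show poch (1 + α) p.1 = poch α p.1 * (α + p.1) / α by rw [← hr]; field_simp]
  field_simp

/-- The general term of the Gauss hypergeometric series regularized by `1 / Γ(c)`. -/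
def regTerm (A B c u : ℂ) (n : ℕ) : ℂ :=
  poch A n * poch B n / n.factorial * (Gamma (c + n))⁻¹ * u ^ n

/-- The Gauss hypergeometric function regularized by `1 / Γ(c)`. -/
def regHyp (A B c u : ℂ) : ℂ := ∑' n, regTerm A B c u n

theorem tendsto_norm_const_add_natCast (c : ℂ) :
    Tendsto (fun n : ℕ => ‖c + n‖) atTop atTop := by
  refine tendsto_atTop_mono (f := fun n : ℕ => -‖c‖ + (n : ℝ)) (fun n => ?_)
    (tendsto_atTop_add_const_left _ _ tendsto_natCast_atTop_atTop)
  have h1 := norm_sub_le (c + n) c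
  rw [add_sub_cancel_left, norm_natCast] at h1
  linarith

theorem tendsto_inv_const_add_natCast (c : ℂ) :
    Tendsto (fun n : ℕ => (c + n)⁻¹) atTop (𝓝 0) := by
  rw [tendsto_zero_iff_norm_tendsto_zero]
  simp only [norm_inv]
  exact (tendsto_norm_const_add_natCast c).inv_tendsto_atTop

theorem eventually_const_add_natCast_ne_zero (c : ℂ) : ∀ᶠ n : ℕ in atTop, c + n ≠ 0 := by
  filter_upwards [(tendsto_norm_const_add_natCast c).eventually_gt_atTop 0] with n hn
  exact norm_pos_iff.mp hn

theorem tendsto_const_add_natCast_div (A c : ℂ) :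
    Tendsto (fun n : ℕ => (A + n) / (c + n)) atTop (𝓝 1) := by
  have h : Tendsto (fun n : ℕ => 1 + (A - c) * (c + n)⁻¹) atTop (𝓝 (1 + (A - c) * 0)) :=
    ((tendsto_inv_const_add_natCast c).const_mul _).const_add _
  rw [mul_zero, add_zero] at h
  refine h.congr' ?_
  filter_upwards [eventually_const_add_natCast_ne_zero c] with n hn
  field_simp
  ring

theorem inv_Gamma_shift (s : ℂ) : (Gamma s)⁻¹ = s * (Gamma (s + 1))⁻¹ :=
  one_div_Gamma_eq_self_mul_one_div_Gamma_add_one s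

theorem summable_norm_regTerm (A B c : ℂ) {u : ℂ} (hu : ‖u‖ < 1) :
    Summable fun n => ‖regTerm A B c u n‖ := by
  obtain ⟨r, hr, hr1⟩ := exists_between hu
  refine summable_of_ratio_norm_eventually_le hr1 ?_
  have h := (((tendsto_const_add_natCast_div A c).mul
    (tendsto_const_add_natCast_div B 1)).mul_const u).norm
  rw [one_mul, one_mul] at h
  filter_upwards [h.eventually_lt_const hr, eventually_const_add_natCast_ne_zero c] with n hn hc
  have h1 : (1 : ℂ) + n ≠ 0 := by rw [add_comm]; exact Nat.cast_add_one_ne_zero n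
  have hn' : (n.factorial : ℂ) ≠ 0 := Nat.cast_ne_zero.mpr n.factorial_ne_zero
  have e : regTerm A B c u (n + 1) =
      ((A + n) / (c + n) * ((B + n) / (1 + n)) * u) * regTerm A B c u n := by
    rw [regTerm, regTerm, poch_succ, poch_succ, inv_Gamma_shift (c + n), Nat.factorial_succ,
      show c + ((n + 1 : ℕ) : ℂ) = c + n + 1 by push_cast; ring, pow_succ]
    push_cast
    rw [add_comm (n : ℂ) 1]
    field_simp
  rw [norm_norm, norm_norm, e, norm_mul]
  exact mul_le_mul_of_nonneg_right hn.le (norm_nonneg _)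

theorem summable_regTerm (A B c : ℂ) {u : ℂ} (hu : ‖u‖ < 1) :
    Summable (regTerm A B c u) :=
  (summable_norm_regTerm A B c hu).of_norm

/-- A contiguous relation. -/
theorem regHyp_contiguous (A B c : ℂ) {u : ℂ} (hu : ‖u‖ < 1) :
    A * regHyp (A + 1) B c u = regHyp A B (c - 1) u - (c - 1 - A) * regHyp A B c u := by
  rw [regHyp, regHyp, regHyp, ← tsum_mul_left, ← tsum_mul_left,
    ← (summable_regTerm A B (c - 1) hu).tsum_sub ((summable_regTerm A B c hu).mul_left _)]
  refine tsum_congr fun n => ?_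
  have h := poch_ratio_succ A n
  rw [regTerm, regTerm, regTerm, inv_Gamma_shift (c - 1 + n),
    show c - 1 + (n : ℂ) + 1 = c + n by ring, add_comm A 1]
  linear_combination (poch B n / n.factorial * (Gamma (c + n))⁻¹ * u ^ n) * h

theorem norm_half_lt_one : ‖(1 / 2 : ℂ)‖ < 1 := by norm_num

theorem regHyp_half_add_two (a x : ℂ) :
    regHyp a (1 - a) x (1 / 2) =
      (x + a) * (x + 1 - a) * regHyp a (1 - a) (x + 2) (1 / 2) := by
  set G : ℕ → ℂ := fun n => 2 * n * regTerm a (1 - a) (x + 1) (1 / 2) n with hG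
  have hG1 : ∀ n, G (n + 1) = a * (1 - a) * regTerm (a + 1) (2 - a) (x + 2) (1 / 2) n := by
    intro n
    have hn' : (n.factorial : ℂ) ≠ 0 := Nat.cast_ne_zero.mpr n.factorial_ne_zero
    have h1 : (n : ℂ) + 1 ≠ 0 := Nat.cast_add_one_ne_zero n
    simp only [hG, regTerm]
    rw [poch_succ_left, poch_succ_left, Nat.factorial_succ,
      show x + 1 + ((n + 1 : ℕ) : ℂ) = x + 2 + n by push_cast; ring,
      show 1 - a + 1 = 2 - a by ring, pow_succ]
    push_cast
    field_simp
  have hs1 : Summable fun n => G (n + 1) := by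
    simp only [hG1]
    exact (summable_regTerm _ _ _ norm_half_lt_one).mul_left _
  have hs : Summable G := (summable_nat_add_iff 1).mp hs1
  have h0 : ∑' n, (G n - G (n + 1)) = 0 := by
    rw [hs.tsum_sub hs1, hs.tsum_eq_zero_add]
    simp [hG]
  rw [← sub_eq_zero, ← h0, regHyp, regHyp, ← tsum_mul_left,
    ← (summable_regTerm a (1 - a) x norm_half_lt_one).tsum_sub
      ((summable_regTerm a (1 - a) (x + 2) norm_half_lt_one).mul_left _)]
  refine tsum_congr fun n => ?_
  have e : G (n + 1) = (a + n) * (1 - a + n) * regTerm a (1 - a) (x + 2) (1 / 2) n := by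
    have h1 := poch_succ_left a n
    have h2 := poch_succ_left (1 - a) n
    rw [poch_succ] at h1 h2
    rw [hG1, regTerm, regTerm, show 2 - a = 1 - a + 1 by ring]
    have : a * (1 - a) * (poch (a + 1) n * poch (1 - a + 1) n) =
      (poch a n * (a + n)) * (poch (1 - a) n * (1 - a + n)) := by rw [h1, h2]; ring
    linear_combination ((n.factorial : ℂ)⁻¹ * (Gamma (x + 2 + n))⁻¹ * (1 / 2) ^ n) * this
  rw [e]
  simp only [hG, regTerm]
  rw [inv_Gamma_shift (x + n), inv_Gamma_shift (x + n + 1),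
    show x + (n : ℂ) + 1 + 1 = x + 2 + n by ring, inv_Gamma_shift (x + 1 + n),
    show x + 1 + (n : ℂ) + 1 = x + 2 + n by ring]
  ring

theorem Gamma_add_natCast {c : ℂ} (hc : notNonposInt c) (n : ℕ) :
    Gamma (c + n) = poch c n * Gamma c := by
  induction n with
  | zero => simp [poch_zero]
  | succ n ih =>
    have : c + n ≠ 0 := fun h => hc n (eq_neg_of_add_eq_zero_left h)
    rw [show c + ((n + 1 : ℕ) : ℂ) = c + n + 1 by push_cast; ring, Gamma_add_one _ this, ih,
      poch_succ]
    ring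

theorem notNonposInt_of_re_pos {c : ℂ} (hc : 0 < c.re) : notNonposInt c := by
  intro n h
  rw [h] at hc
  simp only [neg_re, natCast_re] at hc
  have : (0 : ℝ) ≤ n := n.cast_nonneg
  linarith

theorem Gamma_ne_zero_of_notNonposInt {c : ℂ} (hc : notNonposInt c) : Gamma c ≠ 0 :=
  Gamma_ne_zero hc

theorem factorial_le_norm_poch {c : ℂ} (hc : 1 ≤ c.re) (n : ℕ) :
    (n.factorial : ℝ) ≤ ‖poch c n‖ := by
  rw [poch, norm_prod, ← prod_range_add_one_eq_factorial]
  push_cast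
  refine prod_le_prod (fun _ _ => by positivity) fun k _ => ?_
  refine le_trans ?_ (re_le_norm _)
  simp only [add_re, natCast_re]
  linarith

theorem tendsto_regHyp_mul_Gamma (a : ℂ) {x : ℂ} (hx : 1 ≤ x.re) :
    Tendsto (fun K : ℕ => regHyp a (1 - a) (x + 2 * K) (1 / 2) * Gamma (x + 2 * K)) atTop
      (𝓝 1) := by
  have hre : ∀ K : ℕ, 1 ≤ (x + 2 * K).re := fun K => by
    have : (0 : ℝ) ≤ K := K.cast_nonneg
    simp
    linarith
  have e : ∀ K : ℕ, regHyp a (1 - a) (x + 2 * K) (1 / 2) * Gamma (x + 2 * K) =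
      ∑' n, poch a n * poch (1 - a) n / n.factorial * (1 / 2) ^ n *
        (poch (x + 2 * K) n)⁻¹ := by
    intro K
    have h := notNonposInt_of_re_pos (zero_lt_one.trans_le (hre K))
    rw [regHyp, ← tsum_mul_right]
    refine tsum_congr fun n => ?_
    have := Gamma_ne_zero_of_notNonposInt h
    rw [regTerm, Gamma_add_natCast h, mul_inv]
    field_simp
  simp only [e]
  rw [show 𝓝 (1 : ℂ) = 𝓝 (∑' n : ℕ, if n = 0 then (1 : ℂ) else 0) by rw [tsum_ite_eq]]
  refine tendsto_tsum_of_dominated_convergence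
    (summable_norm_regTerm a (1 - a) 1 norm_half_lt_one) ?_ ?_
  · rintro (_ | n)
    · simp [poch_zero]
    · have : Tendsto (fun K : ℕ => (poch (x + 2 * K) (n + 1))⁻¹) atTop (𝓝 0) := by
        have h2 : Tendsto (fun K : ℕ => 2⁻¹ * (x / 2 + K)⁻¹) atTop (𝓝 (2⁻¹ * 0)) :=
          (tendsto_inv_const_add_natCast (x / 2)).const_mul _
        rw [mul_zero] at h2
        refine squeeze_zero_norm (fun K => ?_) (tendsto_zero_iff_norm_tendsto_zero.mp h2)
        rw [← mul_inv, show 2 * (x / 2 + (K : ℂ)) = x + 2 * K by ring, norm_inv, norm_inv,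
          poch_succ_left, norm_mul]
        have h3 : 1 ≤ ‖poch (x + 2 * K + 1) n‖ := by
          refine le_trans ?_ (factorial_le_norm_poch ?_ n)
          · exact_mod_cast n.factorial_pos
          · have := hre K
            rw [add_re, one_re]
            linarith
        have h4 : 0 < ‖x + 2 * K‖ :=
          (zero_lt_one.trans_le (hre K)).trans_le (re_le_norm _)
        exact inv_anti₀ h4 (le_mul_of_one_le_right h4.le h3)
      simpa using this.const_mul
        (poch a (n + 1) * poch (1 - a) (n + 1) / (n + 1).factorial * (1 / 2) ^ (n + 1))
  · refine Eventually.of_forall fun K n => ?_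
    rw [regTerm, add_comm (1 : ℂ), Gamma_nat_eq_factorial, mul_right_comm _ _ ((1 / 2 : ℂ) ^ n),
      norm_mul, norm_mul _ ((n.factorial : ℂ)⁻¹), norm_inv, norm_inv, norm_natCast]
    exact mul_le_mul_of_nonneg_left
      (inv_anti₀ (by exact_mod_cast n.factorial_pos) (factorial_le_norm_poch (hre K) n))
      (norm_nonneg _)

theorem tendsto_poch_div (s : ℂ) :
    Tendsto (fun K : ℕ => poch s (K + 1) / ((K : ℂ) ^ s * K.factorial)) atTop
      (𝓝 (Gamma s)⁻¹) := by
  by_cases h : Gamma s = 0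
  · obtain ⟨m, rfl⟩ := (Gamma_eq_zero_iff s).mp h
    rw [h, inv_zero]
    refine tendsto_const_nhds.congr' ?_
    filter_upwards [eventually_ge_atTop m] with K hK
    have : poch (-(m : ℂ)) (K + 1) = 0 :=
      prod_eq_zero (mem_range.mpr (Nat.lt_succ_of_le hK)) (by simp)
    rw [this, zero_div]
  · refine ((GammaSeq_tendsto_Gamma s).inv₀ h).congr fun K => ?_
    rw [GammaSeq, inv_div, poch]

theorem poch_two_mul (x : ℂ) (K : ℕ) :
    poch x (2 * K) = 4 ^ K * poch (x / 2) K * poch ((x + 1) / 2) K := by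
  induction K with
  | zero => simp [poch_zero]
  | succ K ih =>
    rw [show 2 * (K + 1) = 2 * K + 1 + 1 by ring, poch_succ, poch_succ, ih, poch_succ, poch_succ]
    push_cast
    ring

theorem regHyp_half_iterate (a x : ℂ) (K : ℕ) :
    regHyp a (1 - a) x (1 / 2) = 4 ^ K * poch ((x + a) / 2) K * poch ((x + 1 - a) / 2) K *
      regHyp a (1 - a) (x + 2 * K) (1 / 2) := by
  induction K with
  | zero => simp [poch_zero]
  | succ K ih =>
    rw [ih, regHyp_half_add_two a (x + 2 * K), poch_succ, poch_succ,
      show x + 2 * ((K + 1 : ℕ) : ℂ) = x + 2 * K + 2 by push_cast; ring]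
    ring

theorem tendsto_poch_ratio {p q r s : ℂ} (h : p + q = r + s) (hr : notNonposInt r)
    (hs : notNonposInt s) :
    Tendsto (fun K : ℕ => poch p (K + 1) * poch q (K + 1) / (poch r (K + 1) * poch s (K + 1)))
      atTop (𝓝 (Gamma r * Gamma s * (Gamma p)⁻¹ * (Gamma q)⁻¹)) := by
  have hr' := Gamma_ne_zero_of_notNonposInt hr
  have hs' := Gamma_ne_zero_of_notNonposInt hs
  have h1 := ((tendsto_poch_div p).mul (tendsto_poch_div q)).div
    ((tendsto_poch_div r).mul (tendsto_poch_div s))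
    (mul_ne_zero (inv_ne_zero hr') (inv_ne_zero hs'))
  have e : Gamma r * Gamma s * (Gamma p)⁻¹ * (Gamma q)⁻¹ =
      (Gamma p)⁻¹ * (Gamma q)⁻¹ / ((Gamma r)⁻¹ * (Gamma s)⁻¹) := by
    rw [← mul_inv (Gamma r), div_inv_eq_mul]; ring
  rw [e]
  refine h1.congr' ?_
  filter_upwards [eventually_gt_atTop 0] with K hK
  have hK' : (K : ℂ) ≠ 0 := Nat.cast_ne_zero.mpr hK.ne'
  have hf : (K.factorial : ℂ) ≠ 0 := Nat.cast_ne_zero.mpr K.factorial_ne_zero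
  have hpow : (K : ℂ) ^ p * (K : ℂ) ^ q = (K : ℂ) ^ r * (K : ℂ) ^ s := by
    rw [← cpow_add _ _ hK', ← cpow_add _ _ hK', h]
  have hp0 : ∀ z : ℂ, (K : ℂ) ^ z ≠ 0 := fun z => by simp [cpow_eq_zero_iff, hK']
  rw [Pi.div_apply, div_mul_div_comm, div_mul_div_comm,
    show (K : ℂ) ^ p * K.factorial * ((K : ℂ) ^ q * K.factorial) =
      ((K : ℂ) ^ p * (K : ℂ) ^ q) * (K.factorial * K.factorial) by ring, hpow,
    show (K : ℂ) ^ r * K.factorial * ((K : ℂ) ^ s * K.factorial) =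
      ((K : ℂ) ^ r * (K : ℂ) ^ s) * (K.factorial * K.factorial) by ring,
    div_div_div_cancel_right₀]
  exact mul_ne_zero (mul_ne_zero (hp0 r) (hp0 s)) (mul_ne_zero hf hf)

theorem regHyp_half_of_one_le_re (a : ℂ) {x : ℂ} (hx : 1 ≤ x.re) :
    regHyp a (1 - a) x (1 / 2) = (2 : ℂ) ^ (1 - x) * (√Real.pi : ℝ) *
      (Gamma ((x + a) / 2))⁻¹ * (Gamma ((x + 1 - a) / 2))⁻¹ := by
  have hxn := notNonposInt_of_re_pos (zero_lt_one.trans_le hx)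
  have hG := Gamma_ne_zero_of_notNonposInt hxn
  have hr : notNonposInt (x / 2) := notNonposInt_of_re_pos (by
    rw [show x / 2 = x / ((2 : ℝ) : ℂ) by norm_num, div_ofReal_re]; linarith)
  have hs : notNonposInt ((x + 1) / 2) := notNonposInt_of_re_pos (by
    rw [show (x + 1) / 2 = (x + 1) / ((2 : ℝ) : ℂ) by norm_num, div_ofReal_re, add_re, one_re]
    linarith)
  have hdup := Gamma_mul_Gamma_add_half (x / 2)
  rw [show x / 2 + 1 / 2 = (x + 1) / 2 by ring, show 2 * (x / 2) = x by ring] at hdup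
  have hlim := (tendsto_poch_ratio (p := (x + a) / 2) (q := (x + 1 - a) / 2)
    (by ring) hr hs).mul ((tendsto_regHyp_mul_Gamma a hx).comp (tendsto_add_atTop_nat 1))
  have hconst : ∀ K : ℕ, poch ((x + a) / 2) (K + 1) * poch ((x + 1 - a) / 2) (K + 1) /
      (poch (x / 2) (K + 1) * poch ((x + 1) / 2) (K + 1)) *
      ((fun K : ℕ => regHyp a (1 - a) (x + 2 * K) (1 / 2) * Gamma (x + 2 * K)) ∘
        fun K => K + 1) K = regHyp a (1 - a) x (1 / 2) * Gamma x := by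
    intro K
    have h2 := Gamma_add_natCast hxn (2 * (K + 1))
    have h3 := Gamma_add_natCast hr (K + 1)
    have h4 := Gamma_add_natCast hs (K + 1)
    have hne : ∀ {c : ℂ}, notNonposInt c → poch c (K + 1) ≠ 0 := by
      intro c hc
      rw [poch, prod_ne_zero_iff]
      exact fun k _ h => hc k (eq_neg_of_add_eq_zero_left h)
    have h5 := hne hr
    have h6 := hne hs
    rw [poch_two_mul] at h2
    simp only [Function.comp_apply]
    rw [regHyp_half_iterate a x (K + 1),
      show x + 2 * ((K + 1 : ℕ) : ℂ) = x + ((2 * (K + 1) : ℕ) : ℂ) by push_cast; ring, h2]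
    field_simp
  have huniq := tendsto_nhds_unique (tendsto_const_nhds.congr fun K => (hconst K).symm) hlim
  rw [mul_one, hdup] at huniq
  refine mul_right_cancel₀ hG (huniq.trans ?_)
  ring

/-- Bailey's theorem for the regularized hypergeometric function at `1 / 2`. -/
theorem regHyp_half (a x : ℂ) :
    regHyp a (1 - a) x (1 / 2) = (2 : ℂ) ^ (1 - x) * (√Real.pi : ℝ) *
      (Gamma ((x + a) / 2))⁻¹ * (Gamma ((x + 1 - a) / 2))⁻¹ := by
  obtain ⟨K, hK⟩ := exists_nat_ge (1 - x.re)
  induction K generalizing x with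
  | zero => exact regHyp_half_of_one_le_re a (by simpa using hK)
  | succ K ih =>
    rw [regHyp_half_add_two, ih (x + 2) (by
      push_cast at hK; rw [add_re]; norm_num; linarith), inv_Gamma_shift ((x + a) / 2),
      inv_Gamma_shift ((x + 1 - a) / 2), show (x + 2 + a) / 2 = (x + a) / 2 + 1 by ring,
      show (x + 2 + 1 - a) / 2 = (x + 1 - a) / 2 + 1 by ring,
      show (1 : ℂ) - x = 1 - (x + 2) + 2 by ring, cpow_add _ _ two_ne_zero, cpow_ofNat]
    ring

theorem two_cpow_mul_regHyp_half (a x : ℂ) (h : notNonposInt ((x - a) / 2)) :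
    (2 : ℂ) ^ a * regHyp a (1 - a) x (1 / 2) =
      (Gamma (x - a))⁻¹ * (Gamma ((x - a) / 2) / Gamma ((x + a) / 2)) := by
  have hs := Gamma_ne_zero_of_notNonposInt h
  have hdup := Gamma_mul_Gamma_add_half ((x - a) / 2)
  rw [show (x - a) / 2 + 1 / 2 = (x + 1 - a) / 2 by ring,
    show 2 * ((x - a) / 2) = x - a by ring] at hdup
  have h2 : (2 : ℂ) ^ (1 - (x - a)) ≠ 0 := by simp [cpow_eq_zero_iff]
  have hpi : ((√Real.pi : ℝ) : ℂ) ≠ 0 := by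
    exact_mod_cast (Real.sqrt_pos.mpr Real.pi_pos).ne'
  have hpow : (2 : ℂ) ^ a * (2 : ℂ) ^ (1 - x) = (2 : ℂ) ^ (1 - (x - a)) := by
    rw [← cpow_add _ _ two_ne_zero]; congr 1; ring
  have key : (2 : ℂ) ^ (1 - (x - a)) * (√Real.pi : ℝ) * (Gamma ((x + 1 - a) / 2))⁻¹ =
      (Gamma (x - a))⁻¹ * Gamma ((x - a) / 2) := by
    by_cases h0 : Gamma ((x + 1 - a) / 2) = 0
    · have : Gamma (x - a) = 0 := by
        rw [h0, mul_zero] at hdup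
        simpa [h2, hpi] using hdup.symm
      rw [h0, this]; simp
    · have : Gamma (x - a) ≠ 0 := by
        intro h3
        rw [h3, zero_mul, zero_mul] at hdup
        exact mul_ne_zero hs h0 hdup
      field_simp
      linear_combination -hdup
  rw [regHyp_half, div_eq_mul_inv (Gamma ((x - a) / 2))]
  generalize (Gamma ((x + a) / 2))⁻¹ = g
  linear_combination g * key +
    (√Real.pi : ℝ) * g * (Gamma ((x + 1 - a) / 2))⁻¹ * hpow

/-- The generalized Bailey theorem at `1 / 2`. -/
theorem two_cpow_mul_poch_mul_regHyp_half (i : ℕ) (a : ℂ) : ∀ c : ℂ,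
    (∀ r : ℕ, r ≤ i → notNonposInt ((c - i + r - a) / 2)) →
    (2 : ℂ) ^ a * poch a i * regHyp (a + i) (1 - a) c (1 / 2) =
      (Gamma (c - a - i))⁻¹ * ∑ r ∈ range (i + 1), (i.choose r : ℂ) *
        ((-1) ^ r * (Gamma ((c - i + r - a) / 2) / Gamma ((c - i + r + a) / 2))) := by
  induction i with
  | zero =>
    intro c hc
    have := hc 0 le_rfl
    simp only [Nat.cast_zero, sub_zero, add_zero] at this
    simpa [poch_zero] using two_cpow_mul_regHyp_half a c this
  | succ i ih =>
    intro c hc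
    have i1 := ih (c - 1) fun r hr => by
      have := hc r (by omega)
      push_cast at this
      rwa [show c - (i + 1) + r - a = c - 1 - i + r - a by ring] at this
    have i2 := ih c fun r hr => by
      have := hc (r + 1) (by omega)
      push_cast at this
      rwa [show c - (i + 1) + (r + 1) - a = c - i + r - a by ring] at this
    have hcont := regHyp_contiguous (a + i) (1 - a) c norm_half_lt_one
    rw [Finset.sum_choose_succ_mul (fun r _ => (-1 : ℂ) ^ r *
      (Gamma ((c - (i + 1 : ℕ) + r - a) / 2) / Gamma ((c - (i + 1 : ℕ) + r + a) / 2))) i]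
    have s1 : ∀ r ∈ range (i + 1), (i.choose r : ℂ) * ((-1 : ℂ) ^ r *
        (Gamma ((c - (i + 1 : ℕ) + r - a) / 2) / Gamma ((c - (i + 1 : ℕ) + r + a) / 2))) =
        (i.choose r : ℂ) * ((-1 : ℂ) ^ r *
        (Gamma ((c - 1 - i + r - a) / 2) / Gamma ((c - 1 - i + r + a) / 2))) := by
      intro r _
      rw [show c - ((i + 1 : ℕ) : ℂ) = c - 1 - i by push_cast; ring]
    have s2 : ∀ r ∈ range (i + 1), (i.choose r : ℂ) * ((-1 : ℂ) ^ (r + 1) *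
        (Gamma ((c - (i + 1 : ℕ) + (r + 1 : ℕ) - a) / 2) /
          Gamma ((c - (i + 1 : ℕ) + (r + 1 : ℕ) + a) / 2))) =
        -((i.choose r : ℂ) * ((-1 : ℂ) ^ r *
        (Gamma ((c - i + r - a) / 2) / Gamma ((c - i + r + a) / 2)))) := by
      intro r _
      rw [show c - ((i + 1 : ℕ) : ℂ) + ((r + 1 : ℕ) : ℂ) = c - i + r by push_cast; ring]
      ring
    rw [sum_congr rfl s1, sum_congr rfl s2, sum_neg_distrib, poch_succ,
      show c - a - ((i + 1 : ℕ) : ℂ) = c - 1 - a - i by push_cast; ring,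
      show a + ((i + 1 : ℕ) : ℂ) = a + i + 1 by push_cast; ring]
    rw [inv_Gamma_shift (c - 1 - a - i), show c - 1 - a - (i : ℂ) + 1 = c - a - i by ring] at i1 ⊢
    linear_combination (2 : ℂ) ^ a * poch a i * hcont + i1 - (c - 1 - a - i) * i2

theorem tsum_eq_tsum_sum_antidiagonal {f : ℕ × ℕ → ℂ} (hf : Summable f) :
    ∑' p, f p = ∑' N, ∑ p ∈ antidiagonal N, f p := by
  conv_rhs => congr; ext; rw [← Finset.sum_finset_coe, ← tsum_fintype (L := .unconditional _)]
  rw [← HasAntidiagonal.sigmaAntidiagonalEquivProd.tsum_eq f]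
  exact (HasAntidiagonal.sigmaAntidiagonalEquivProd.summable_iff.mpr hf).tsum_sigma'
    fun n => (hasSum_fintype _).summable

theorem summable_norm_sum_antidiagonal {f : ℕ × ℕ → ℂ} (hf : Summable fun p => ‖f p‖) :
    Summable fun N => ‖∑ p ∈ antidiagonal N, f p‖ := by
  have h : Summable fun N => ∑ p ∈ antidiagonal N, ‖f p‖ := by
    conv => congr; ext; rw [← Finset.sum_finset_coe, ← tsum_fintype (L := .unconditional _)]
    exact (HasAntidiagonal.sigmaAntidiagonalEquivProd.summable_iff.mpr hf).sigma'
      fun n => (hasSum_fintype _).summable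
  exact h.of_nonneg_of_le (fun _ => norm_nonneg _) fun _ => norm_sum_le _ _

theorem poch_eq_ascPochhammer_eval (a : ℂ) (n : ℕ) :
    poch a n = (ascPochhammer ℂ n).eval a := by
  induction n with
  | zero => simp [poch_zero]
  | succ n ih => rw [poch_succ, ascPochhammer_succ_eval, ih]

theorem ring_choose_eq_poch_div (a : ℂ) (n : ℕ) :
    Ring.choose (a + n - 1) n = poch a n / n.factorial := by
  have hn : (n.factorial : ℂ) ≠ 0 := Nat.cast_ne_zero.mpr n.factorial_ne_zero
  rw [← Ring.multichoose_eq, eq_div_iff hn, poch_eq_ascPochhammer_eval,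
    ← Polynomial.ascPochhammer_smeval_eq_eval, ← Ring.factorial_nsmul_multichoose_eq_ascPochhammer,
    nsmul_eq_mul, mul_comm]

/-- The binomial series. -/
theorem hasSum_poch_div_factorial_mul_pow (s : ℂ) {x : ℂ} (hx : ‖x‖ < 1) :
    HasSum (fun n : ℕ => poch s n / n.factorial * x ^ n) ((1 - x) ^ (-s)) := by
  have h := (one_div_one_sub_cpow_hasFPowerSeriesOnBall_zero s).hasSum (y := x)
    (by rwa [mem_eball_zero_iff, ← ofReal_norm, ENNReal.ofReal_lt_one])
  rw [zero_add, one_div, ← cpow_neg] at h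
  refine h.congr_fun ?_
  intro n
  simp [FormalMultilinearSeries.ofScalars, ring_choose_eq_poch_div, mul_comm]

theorem norm_poch_div_factorial_le {s : ℂ} {M : ℕ} (hM : ‖s‖ ≤ M) (k j : ℕ) :
    ‖poch (s + k) j / j.factorial‖ ≤ 2 ^ M * 2 ^ k * 2 ^ j := by
  have hj : (0 : ℝ) < j.factorial := by exact_mod_cast j.factorial_pos
  have h1 : ‖poch (s + k) j‖ ≤ ((M + k + 1).ascFactorial j : ℕ) := by
    rw [Nat.ascFactorial_eq_prod_range, poch, norm_prod]
    push_cast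
    refine prod_le_prod (fun _ _ => norm_nonneg _) fun l _ => ?_
    refine (norm_add_le _ _).trans ?_
    have := norm_add_le s k
    rw [norm_natCast] at this ⊢
    linarith
  rw [norm_div, norm_natCast, div_le_iff₀ hj, ← pow_add, ← pow_add]
  refine h1.trans ?_
  rw [Nat.ascFactorial_eq_factorial_mul_choose, Nat.cast_mul, mul_comm]
  refine mul_le_mul_of_nonneg_right ?_ hj.le
  exact_mod_cast Nat.choose_le_two_pow _ _

theorem differentiableOn_tsum_mul_pow {c : ℕ → ℂ}
    (hc : ∀ u : ℂ, ‖u‖ < 1 → Summable fun n => ‖c n * u ^ n‖) :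
    DifferentiableOn ℂ (fun u => ∑' n, c n * u ^ n) (Metric.ball 0 1) := by
  intro u hu
  rw [mem_ball_zero_iff] at hu
  obtain ⟨r, hr, hr1⟩ := exists_between hu
  have hr0 : 0 < r := (norm_nonneg u).trans_lt hr
  have hs := hc r (by simpa [abs_of_pos hr0] using hr1)
  have hd : DifferentiableOn ℂ (fun u => ∑' n, c n * u ^ n) (Metric.ball 0 r) := by
    refine differentiableOn_tsum_of_summable_norm hs
      (fun n => (Differentiable.differentiableOn (by fun_prop))) Metric.isOpen_ball ?_
    intro n w hw
    rw [mem_ball_zero_iff] at hw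
    rw [norm_mul, norm_mul, norm_pow, norm_pow, norm_real, Real.norm_of_nonneg hr0.le]
    gcongr
  exact (hd.differentiableAt (Metric.isOpen_ball.mem_nhds (by simpa using hr))).differentiableWithinAt

/-- The coefficients of the Euler transform of a power series. -/
def eulerCoeff (s : ℂ) (h : ℕ → ℂ) (N : ℕ) : ℂ :=
  ∑ p ∈ antidiagonal N, (-1) ^ p.1 * h p.1 * (poch (s + p.1) p.2 / p.2.factorial)

theorem tsum_eulerCoeff_mul_pow_of_norm_lt (s : ℂ) {h : ℕ → ℂ}
    (hh : ∀ u : ℂ, ‖u‖ < 1 → Summable fun n => ‖h n * u ^ n‖) {x : ℂ} (hx : ‖x‖ < 1 / 2) :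
    ∑' N, eulerCoeff s h N * x ^ N = (1 - x) ^ (-s) * ∑' n, h n * (x / (x - 1)) ^ n := by
  have hx1 : ‖x‖ < 1 := by linarith
  have hx2 : ‖2 * x‖ < 1 := by rw [norm_mul]; norm_num; linarith
  have h1x : 1 - x ≠ 0 := by
    intro h
    rw [← sub_eq_zero.mp h] at hx1
    simp at hx1
  have h1x' : x - 1 ≠ 0 := by rwa [← neg_ne_zero, neg_sub]
  set g : ℕ × ℕ → ℂ := fun p =>
    (h p.1 * (-x) ^ p.1) * (poch (s + p.1) p.2 / p.2.factorial * x ^ p.2) with hg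
  obtain ⟨M, hM⟩ := exists_nat_ge ‖s‖
  have hgs : Summable fun p => ‖g p‖ := by
    have hb := ((hh (2 * x) hx2).mul_of_nonneg
      (summable_geometric_of_lt_one (norm_nonneg _) hx2) (fun _ => norm_nonneg _)
      (fun _ => by positivity)).mul_left ((2 : ℝ) ^ M)
    refine hb.of_nonneg_of_le (fun _ => norm_nonneg _) fun p => ?_
    rw [hg, norm_mul, norm_mul, norm_mul, norm_mul, norm_pow, norm_neg, norm_pow, norm_pow,
      norm_mul, RCLike.norm_ofNat, mul_pow, mul_pow]
    calc _ ≤ ‖h p.1‖ * ‖x‖ ^ p.1 * ((2 ^ M * 2 ^ p.1 * 2 ^ p.2) * ‖x‖ ^ p.2) := by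
          gcongr
          exact norm_poch_div_factorial_le hM _ _
      _ = _ := by ring
  have e1 : ∀ N, eulerCoeff s h N * x ^ N = ∑ p ∈ antidiagonal N, g p := by
    intro N
    rw [eulerCoeff, sum_mul]
    refine sum_congr rfl fun p hp => ?_
    simp only [hg]
    rw [← mem_antidiagonal.mp hp, pow_add, neg_pow x]
    ring
  have e2 : ∀ k, ∑' j, g (k, j) = (1 - x) ^ (-s) * (h k * (x / (x - 1)) ^ k) := by
    intro k
    simp only [hg]
    rw [tsum_mul_left, (hasSum_poch_div_factorial_mul_pow (s + k) hx1).tsum_eq,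
      show -(s + k) = -s - k by ring, cpow_sub _ _ h1x, cpow_natCast,
      show x / (x - 1) = -x / (1 - x) by rw [← neg_sub x 1, neg_div_neg_eq], div_pow]
    ring
  rw [tsum_congr e1, ← tsum_eq_tsum_sum_antidiagonal hgs.of_norm, hgs.of_norm.tsum_prod,
    tsum_congr e2, tsum_mul_left]

/-- Euler's transformation at the boundary point `-1`, by Abel summation. -/
theorem tsum_eulerCoeff_mul_neg_one_pow (s : ℂ) {h : ℕ → ℂ}
    (hh : ∀ u : ℂ, ‖u‖ < 1 → Summable fun n => ‖h n * u ^ n‖)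
    (hf : Summable fun N => ‖eulerCoeff s h N‖) :
    ∑' N, eulerCoeff s h N * (-1) ^ N = 2 ^ (-s) * ∑' n, h n * (1 / 2) ^ n := by
  set U : Set ℂ := {x | x.re < 1 / 2} with hU
  have hUo : IsOpen U := isOpen_lt continuous_re continuous_const
  have hUc : Convex ℝ U := convex_halfSpace_re_lt _
  have hne : ∀ x ∈ U, x - 1 ≠ 0 := by
    intro x hx h
    rw [hU, Set.mem_ofPred_eq, sub_eq_zero.mp h, one_re] at hx
    norm_num at hx
  have hmaps : ∀ x ∈ U, x / (x - 1) ∈ Metric.ball (0 : ℂ) 1 := by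
    intro x hx
    have hpos : 0 < ‖x - 1‖ := norm_pos_iff.mpr (hne x hx)
    rw [mem_ball_zero_iff, norm_div, div_lt_one hpos]
    refine lt_of_pow_lt_pow_left₀ 2 hpos.le ?_
    rw [← normSq_eq_norm_sq, ← normSq_eq_norm_sq, normSq_apply, normSq_apply]
    simp only [sub_re, sub_im, one_re, one_im]
    have : x.re < 1 / 2 := hx
    nlinarith
  set F : ℂ → ℂ := fun x => ∑' N, eulerCoeff s h N * x ^ N with hF
  set G : ℂ → ℂ := fun x => (1 - x) ^ (-s) * ∑' n, h n * (x / (x - 1)) ^ n with hG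
  have hGd : DifferentiableOn ℂ G U := by
    refine DifferentiableOn.mul ?_ ?_
    · refine DifferentiableOn.cpow_const (by fun_prop) fun x hx => ?_
      left
      have : x.re < 1 / 2 := hx
      rw [sub_re, one_re]
      linarith
    · exact (differentiableOn_tsum_mul_pow hh).comp
        (differentiableOn_id.div (by fun_prop) hne) hmaps
  have hle : ∀ N (x : ℂ), ‖x‖ ≤ 1 → ‖eulerCoeff s h N * x ^ N‖ ≤ ‖eulerCoeff s h N‖ := by
    intro N x hx
    rw [norm_mul, norm_pow]
    exact mul_le_of_le_one_right (norm_nonneg _) (pow_le_one₀ (norm_nonneg _) hx)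
  have hFd : DifferentiableOn ℂ F (Metric.ball 0 1) :=
    differentiableOn_tsum_mul_pow fun u hu =>
      hf.of_nonneg_of_le (fun _ => norm_nonneg _) fun N => hle N u hu.le
  have heq : Set.EqOn F G (Metric.ball 0 1 ∩ U) := by
    have hVo := (Metric.isOpen_ball (x := (0 : ℂ)) (ε := 1)).inter hUo
    have h0 : (0 : ℂ) ∈ Metric.ball 0 1 ∩ U := ⟨by simp, by simp [hU]⟩
    refine ((hFd.mono Set.inter_subset_left).analyticOnNhd hVo).eqOn_of_preconnected_of_eventuallyEq
      ((hGd.mono Set.inter_subset_right).analyticOnNhd hVo)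
      ((convex_ball (0 : ℂ) 1).inter hUc).isPreconnected h0 ?_
    filter_upwards [Metric.ball_mem_nhds (0 : ℂ) (by norm_num : (0 : ℝ) < 1 / 2)] with x hx
    exact tsum_eulerCoeff_mul_pow_of_norm_lt s hh (by simpa using hx)
  have hev : ∀ᶠ t : ℝ in 𝓝[>] (-1 : ℝ), (t : ℂ) ∈ Metric.ball (0 : ℂ) 1 ∩ U := by
    filter_upwards [Ioo_mem_nhdsGT (by norm_num : (-1 : ℝ) < 0)] with t ht
    refine ⟨?_, ?_⟩
    · rw [mem_ball_zero_iff, norm_real, Real.norm_eq_abs, abs_lt]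
      exact ⟨ht.1, by linarith [ht.2]⟩
    · rw [hU, Set.mem_ofPred_eq, ofReal_re]
      linarith [ht.2]
  have hlim0 : Tendsto (fun t : ℝ => (t : ℂ)) (𝓝[>] (-1 : ℝ)) (𝓝 (-1)) := by
    have := (continuous_ofReal.tendsto (-1 : ℝ)).mono_left (nhdsWithin_le_nhds (s := Set.Ioi (-1 : ℝ)))
    simpa using this
  have hFlim : Tendsto (fun t : ℝ => F t) (𝓝[>] (-1 : ℝ)) (𝓝 (F (-1))) := by
    refine tendsto_tsum_of_dominated_convergence hf (fun N => (hlim0.pow N).const_mul _) ?_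
    filter_upwards [hev] with t ht N
    exact hle N t (mem_ball_zero_iff.mp ht.1).le
  have hGlim : Tendsto (fun t : ℝ => G t) (𝓝[>] (-1 : ℝ)) (𝓝 (G (-1))) := by
    have hm : (-1 : ℂ) ∈ U := by rw [hU, Set.mem_ofPred_eq]; norm_num
    exact ((hGd.differentiableAt (hUo.mem_nhds hm)).continuousAt.tendsto).comp hlim0
  have hFG := tendsto_nhds_unique (hFlim.congr' (hev.mono fun t ht => heq ht)) hGlim
  simp only [hF, hG] at hFG
  rw [hFG]
  norm_num
end

theorem stmt_8 (i : ℕ) (α β : ℂ)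
    (hβ : ∀ m n : ℕ, poch β (m + n) ≠ 0)
    (hd1 : ∀ n : ℕ, poch (α / 2) n ≠ 0)
    (hd2 : ∀ n : ℕ, poch (1 + (α + β) / 2) n ≠ 0)
    (hΓ1 : notNonposInt (-α))
    (hΓ2 : notNonposInt (1 + (α + β) / 2))
    (hΓ3 : notNonposInt ((i : ℂ) - α))
    (hΓ4 : notNonposInt (β / 2 + 3 * α / 2 - (i : ℂ) + 1))
    (hΓs : ∀ r : ℕ, r ≤ i →
      notNonposInt (β / 4 + 3 * α / 4 + ((r : ℂ) + 1 - (i : ℂ)) / 2) ∧ notNonposInt (β / 4 - α / 4 + ((r : ℂ) + 1 - (i : ℂ)) / 2))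
    (hsum : Summable fun p : ℕ × ℕ => ‖kdfTerm α (α + β - (i : ℂ)) ((i : ℂ) - α) (1 + α / 2) ((α - β) / 2) β (α / 2) (1 + (α + β) / 2) (-1) (-1) p‖) :
    (∑' p : ℕ × ℕ, kdfTerm α (α + β - (i : ℂ)) ((i : ℂ) - α) (1 + α / 2) ((α - β) / 2) β (α / 2) (1 + (α + β) / 2) (-1) (-1) p) =
      Gamma (-α) * Gamma (1 + (α + β) / 2) /
        (Gamma ((i : ℂ) - α) * Gamma (β / 2 + 3 * α / 2 - (i : ℂ) + 1)) *
      ∑ r ∈ Finset.range (i + 1), (-1 : ℂ) ^ r * (i.choose r : ℂ) *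
        Gamma (β / 4 + 3 * α / 4 + ((r : ℂ) + 1 - (i : ℂ)) / 2) /
        Gamma (β / 4 - α / 4 + ((r : ℂ) + 1 - (i : ℂ)) / 2) := by
  set d := 1 + (α + β) / 2 with hd
  set h : ℕ → ℂ := fun k =>
    poch ((i : ℂ) - α) k * poch (1 + α) k / (poch d k * k.factorial) with hh
  have hreg : ∀ (u : ℂ) (k : ℕ),
      h k * u ^ k = Gamma d * regTerm ((i : ℂ) - α) (1 + α) d u k := by
    intro u k
    have h1 := hd2 k
    have h2 := Gamma_ne_zero_of_notNonposInt hΓ2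
    simp only [hh]
    rw [regTerm, Gamma_add_natCast hΓ2, mul_inv]
    field_simp
  have hhs : ∀ u : ℂ, ‖u‖ < 1 → Summable fun k => ‖h k * u ^ k‖ := by
    intro u hu
    simp only [hreg, norm_mul (Gamma d)]
    exact (summable_norm_regTerm _ _ _ hu).mul_left _
  have hanti : ∀ N, ∑ p ∈ Finset.HasAntidiagonal.antidiagonal N, kdfTerm α (α + β - (i : ℂ)) ((i : ℂ) - α)
      (1 + α / 2) ((α - β) / 2) β (α / 2) d (-1) (-1) p = eulerCoeff α h N * (-1) ^ N := by
    intro N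
    rw [show α + β - (i : ℂ) = β - (i - α) by ring,
      sum_antidiagonal_kdfTerm α β (i - α) N (fun n => by simpa using hβ 0 n) hd1 hd2, mul_comm,
      eulerCoeff]
    congr 1
    refine Finset.sum_congr rfl fun p _ => ?_
    simp only [hh]
    ring
  have hE : Summable fun N => ‖eulerCoeff α h N‖ := by
    simpa [hanti] using summable_norm_sum_antidiagonal hsum
  have hB := two_cpow_mul_poch_mul_regHyp_half i (-α) d fun r hr => by
    convert (hΓs r hr).1 using 1
    rw [hd]
    ring
  rw [tsum_eq_tsum_sum_antidiagonal hsum.of_norm, tsum_congr hanti,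
    tsum_eulerCoeff_mul_neg_one_pow α hhs hE, tsum_congr (hreg (1 / 2)), tsum_mul_left]
  change 2 ^ (-α) * (Gamma d * regHyp ((i : ℂ) - α) (1 + α) d (1 / 2)) = _
  have hG1 := Gamma_add_natCast hΓ1 i
  have hG2 := Gamma_ne_zero_of_notNonposInt hΓ1
  have hG3 := Gamma_ne_zero_of_notNonposInt hΓ3
  rw [show -α + (i : ℂ) = i - α by ring] at hG1 hB
  have hp : poch (-α) i ≠ 0 := fun h0 => hG3 (by rw [hG1, h0, zero_mul])
  have hs : ∑ r ∈ Finset.range (i + 1), (i.choose r : ℂ) *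
      ((-1) ^ r * (Gamma ((d - i + r - -α) / 2) / Gamma ((d - i + r + -α) / 2))) =
      ∑ r ∈ Finset.range (i + 1), (-1 : ℂ) ^ r * (i.choose r : ℂ) *
        Gamma (β / 4 + 3 * α / 4 + ((r : ℂ) + 1 - (i : ℂ)) / 2) /
        Gamma (β / 4 - α / 4 + ((r : ℂ) + 1 - (i : ℂ)) / 2) := by
    refine Finset.sum_congr rfl fun r _ => ?_
    rw [show (d - i + r - -α) / 2 = β / 4 + 3 * α / 4 + ((r : ℂ) + 1 - (i : ℂ)) / 2 by
        rw [hd]; ring,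
      show (d - i + r + -α) / 2 = β / 4 - α / 4 + ((r : ℂ) + 1 - (i : ℂ)) / 2 by
        rw [hd]; ring]
    ring
  rw [hs, sub_neg_eq_add, show d - -α - (i : ℂ) = β / 2 + 3 * α / 2 - (i : ℂ) + 1 by
    rw [hd]; ring] at hB
  have hG4 := Gamma_ne_zero_of_notNonposInt hΓ4
  generalize (∑ r ∈ Finset.range (i + 1), _ : ℂ) = S at hB ⊢
  rw [hG1]
  field_simp at hB ⊢
  linear_combination Gamma d * hB
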